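/- In the RA model with a stubborn agent, for every ε > 0 and every ordinary agent k ∈ {1,…,K−1}, the probability P(Y_k[n] ≤ ε or Y_k[n] ≥ 1−ε) converges to 1 as n → ∞; that is, each ordinary agent's opinion becomes extremal (near 0 or near 1) with probability tending to 1. -/

import Mathlib

open MeasureTheory Filter

/-- **The Random Actions (RA) model with a stubborn agent.**
`K = m + 1 ≥ 2` agents, agent `0` being the stubborn one; `α ∈ (0,1)`; `T` a row-stochastic
trust matrix with first row `(1,0,…,0)`, written in block form `T = [[1,0],[r,Q]]` where
`r i = T (i+1) 0` and `Q i j = T (i+1) (j+1)`; `Q` is irreducible and `r` has a positive entry.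
On a probability space with filtration `ℱ`, the opinion process `X n` takes values in `[0,1]^K`,
is adapted, and satisfies `X_0[n] = 0` a.s.; the action process `A n` takes values in `{0,1}^K`,
is `ℱ (n+1)`-measurable, satisfies `A_0[n] = 0` a.s., and conditionally on `ℱ n` its coordinates
are independent Bernoulli with parameters `X n` (encoded by `hA_cond`: for every finite set `s`
of agents, `E[∏_{k ∈ s} A_k[n] | ℱ n] = ∏_{k ∈ s} X_k[n]` a.s.); the update rule is
`X[n+1] = (1-α) X[n] + α T A[n]`. -/
structure RAStubbornModel (m : ℕ) (Ω : Type*) [mΩ : MeasurableSpace Ω] (μ : Measure Ω) where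
  α : ℝ
  T : Matrix (Fin (m + 1)) (Fin (m + 1)) ℝ
  ℱ : Filtration ℕ mΩ
  X : ℕ → Ω → Fin (m + 1) → ℝ
  A : ℕ → Ω → Fin (m + 1) → ℝ
  hα : α ∈ Set.Ioo (0 : ℝ) 1
  hT_nonneg : ∀ i j, 0 ≤ T i j
  hT_rowsum : ∀ i, ∑ j, T i j = 1
  hT_first : ∀ j, T 0 j = if j = 0 then (1 : ℝ) else 0
  hQ_irred : ∀ i j : Fin m, ∃ n, 1 ≤ n ∧
    0 < ((Matrix.of fun (a b : Fin m) => T a.succ b.succ) ^ n) i j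
  hr_pos : ∃ i : Fin m, 0 < T i.succ 0
  hX_mem : ∀ n ω k, X n ω k ∈ Set.Icc (0 : ℝ) 1
  hX_adapted : ∀ n, Measurable[ℱ n] (X n)
  hX_stub : ∀ n, ∀ᵐ ω ∂μ, X n ω 0 = 0
  hA_val : ∀ n ω k, A n ω k = 0 ∨ A n ω k = 1
  hA_meas : ∀ n, Measurable[ℱ (n + 1)] (A n)
  hA_stub : ∀ n, ∀ᵐ ω ∂μ, A n ω 0 = 0
  hA_cond : ∀ n (s : Finset (Fin (m + 1))),
    μ[fun ω => ∏ k ∈ s, A n ω k | ℱ n] =ᵐ[μ] fun ω => ∏ k ∈ s, X n ω k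
  h_update : ∀ n ω k, X (n + 1) ω k = (1 - α) * X n ω k + α * ∑ j, T k j * A n ω j

section Substochastic

variable {ι : Type*} [Fintype ι] [DecidableEq ι] {Q : Matrix ι ι ℝ}

theorem Matrix.pow_nonneg_of_nonneg (hQ : ∀ i j, 0 ≤ Q i j) (n : ℕ) : ∀ i j, 0 ≤ (Q ^ n) i j := by
  induction n with
  | zero =>
    intro i j
    rw [pow_zero, Matrix.one_apply]
    split_ifs <;> norm_num
  | succ n ih =>
    intro i j
    rw [pow_succ, Matrix.mul_apply]
    exact Finset.sum_nonneg fun l _ => mul_nonneg (ih i l) (hQ l j)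

theorem Matrix.sum_pow_le_one (hQ : ∀ i j, 0 ≤ Q i j) (hrow : ∀ i, ∑ j, Q i j ≤ 1) (n : ℕ) :
    ∀ i, ∑ j, (Q ^ n) i j ≤ 1 := by
  induction n with
  | zero => intro i; simp [Matrix.one_apply]
  | succ n ih =>
    intro i
    calc ∑ j, (Q ^ (n + 1)) i j = ∑ l, (Q ^ n) i l * ∑ j, Q l j := by
          simp_rw [pow_succ, Matrix.mul_apply, Finset.mul_sum]
          exact Finset.sum_comm
      _ ≤ ∑ l, (Q ^ n) i l := Finset.sum_le_sum fun l _ =>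
          mul_le_of_le_one_right (pow_nonneg_of_nonneg hQ n i l) (hrow l)
      _ ≤ 1 := ih i

/-- An irreducible substochastic matrix with a defective row has no nonzero nonnegative
fixed vector. -/
theorem Matrix.eq_zero_of_mulVec_eq_self (hQ : ∀ i j, 0 ≤ Q i j) (hrow : ∀ i, ∑ j, Q i j ≤ 1)
    (hirr : ∀ i j, ∃ n, 0 < (Q ^ n) i j) (hdef : ∃ i, ∑ j, Q i j < 1) {v : ι → ℝ}
    (hv : ∀ i, 0 ≤ v i) (hfix : ∀ i, ∑ j, Q i j * v j = v i) (i : ι) : v i = 0 := by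
  obtain ⟨d, hd⟩ := hdef
  obtain ⟨k, -, hk⟩ := Finset.exists_max_image Finset.univ v ⟨i, Finset.mem_univ i⟩
  have hmax : ∀ j, v j ≤ v k := fun j => hk j (Finset.mem_univ j)
  refine le_antisymm ?_ (hv i)
  by_contra! hpos
  have hMpos : 0 < v k := hpos.trans_le (hmax i)
  have hdlt : v d < v k := by
    calc v d = ∑ j, Q d j * v j := (hfix d).symm
      _ ≤ ∑ j, Q d j * v k :=
          Finset.sum_le_sum fun j _ => mul_le_mul_of_nonneg_left (hmax j) (hQ d j)
      _ = (∑ j, Q d j) * v k := (Finset.sum_mul ..).symm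
      _ < v k := mul_lt_of_lt_one_left hMpos hd
  obtain ⟨n, hn⟩ := hirr k d
  have hpow : ∀ n, (Q ^ n).mulVec v = v := by
    intro n
    induction n with
    | zero => simp
    | succ n ih => rw [pow_succ, ← Matrix.mulVec_mulVec, show Q.mulVec v = v from funext hfix, ih]
  have : v k < v k := by
    calc v k = ∑ j, (Q ^ n) k j * v j := (congrFun (hpow n) k).symm
      _ < ∑ j, (Q ^ n) k j * v k := Finset.sum_lt_sum
          (fun j _ => mul_le_mul_of_nonneg_left (hmax j) (pow_nonneg_of_nonneg hQ n k j))
          ⟨d, Finset.mem_univ d, mul_lt_mul_of_pos_left hdlt hn⟩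
      _ = (∑ j, (Q ^ n) k j) * v k := (Finset.sum_mul ..).symm
      _ ≤ v k := mul_le_of_le_one_left hMpos.le (sum_pow_le_one hQ hrow n k)
  exact this.false

/-- The lazy iteration of an irreducible substochastic matrix with a defective row, started from a
vector with entries in `[0,1]`, tends to zero. -/
theorem tendsto_zero_of_lazy_substochastic (hQ : ∀ i j, 0 ≤ Q i j) (hrow : ∀ i, ∑ j, Q i j ≤ 1)
    (hirr : ∀ i j, ∃ n, 0 < (Q ^ n) i j) (hdef : ∃ i, ∑ j, Q i j < 1)
    {α : ℝ} (hα : α ∈ Set.Ioo (0 : ℝ) 1) {e : ℕ → ι → ℝ} (he0 : ∀ n i, 0 ≤ e n i)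
    (he1 : ∀ i, e 0 i ≤ 1)
    (hstep : ∀ n i, e (n + 1) i = (1 - α) * e n i + α * ∑ j, Q i j * e n j) (i : ι) :
    Tendsto (fun n => e n i) atTop (nhds 0) := by
  let L : (ι → ℝ) → ι → ℝ := fun v i => (1 - α) * v i + α * ∑ j, Q i j * v j
  have hα0 : 0 ≤ 1 - α := sub_nonneg.2 hα.2.le
  have hL : Monotone L := fun v w hvw i =>
    add_le_add (mul_le_mul_of_nonneg_left (hvw i) hα0)
      (mul_le_mul_of_nonneg_left (Finset.sum_le_sum fun j _ =>
        mul_le_mul_of_nonneg_left (hvw j) (hQ i j)) hα.1.le)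
  let f : ℕ → ι → ℝ := fun n => L^[n] 1
  have hf : ∀ n, f (n + 1) = L (f n) := fun n => Function.iterate_succ_apply' L n 1
  have hanti : Antitone f := by
    refine hL.antitone_iterate_of_map_le fun i => ?_
    have := mul_le_mul_of_nonneg_left (hrow i) hα.1.le
    simp only [L, Pi.one_apply, mul_one] at this ⊢
    linarith
  have hef : ∀ n, e n ≤ f n := by
    intro n
    induction n with
    | zero => exact he1
    | succ n ih =>
      rw [hf]
      exact (show e (n + 1) = L (e n) from funext (hstep n)).trans_le (hL ih)
  have hlim : ∀ i, ∃ l, Tendsto (fun n => f n i) atTop (nhds l) := fun i =>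
    ⟨_, tendsto_atTop_ciInf (fun _ _ h => hanti h i)
      ⟨0, by rintro _ ⟨n, rfl⟩; exact (he0 n i).trans (hef n i)⟩⟩
  choose v hv using hlim
  have hv0 : ∀ i, 0 ≤ v i := fun i =>
    ge_of_tendsto' (hv i) fun n => (he0 n i).trans (hef n i)
  have hfix : ∀ i, ∑ j, Q i j * v j = v i := by
    intro i
    have h1 : Tendsto (fun n => L (f n) i) atTop (nhds (L v i)) :=
      ((hv i).const_mul _).add
        ((tendsto_finsetSum _ fun j _ => (hv j).const_mul (Q i j)).const_mul α)
    have h2 : Tendsto (fun n => L (f n) i) atTop (nhds (v i)) := by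
      simpa only [Function.comp_def, hf] using (hv i).comp (tendsto_add_atTop_nat 1)
    have h3 : (1 - α) * v i + α * ∑ j, Q i j * v j = v i := tendsto_nhds_unique h1 h2
    exact mul_left_cancel₀ hα.1.ne' (by linarith)
  have hvi := hv i
  rw [Matrix.eq_zero_of_mulVec_eq_self hQ hrow hirr hdef hv0 hfix i] at hvi
  exact squeeze_zero (fun n => he0 n i) (fun n => hef n i) hvi

end Substochastic

namespace RAStubbornModel

variable {m : ℕ} {Ω : Type*} [MeasurableSpace Ω] {μ : Measure Ω} [IsProbabilityMeasure μ]
  (M : RAStubbornModel m Ω μ)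

theorem integrable_X (n : ℕ) (k : Fin (m + 1)) : Integrable (fun ω => M.X n ω k) μ := by
  have hmeas : Measurable fun ω => M.X n ω k :=
    (measurable_pi_apply k).comp ((M.hX_adapted n).mono (M.ℱ.le n) le_rfl)
  refine Integrable.of_bound hmeas.aestronglyMeasurable 1 (ae_of_all _ fun ω => ?_)
  rw [Real.norm_of_nonneg (M.hX_mem n ω k).1]
  exact (M.hX_mem n ω k).2

theorem integrable_A (n : ℕ) (k : Fin (m + 1)) : Integrable (fun ω => M.A n ω k) μ := by
  have hmeas : Measurable fun ω => M.A n ω k :=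
    (measurable_pi_apply k).comp ((M.hA_meas n).mono (M.ℱ.le (n + 1)) le_rfl)
  refine Integrable.of_bound hmeas.aestronglyMeasurable 1 (ae_of_all _ fun ω => ?_)
  rcases M.hA_val n ω k with h | h <;> simp [h]

theorem integral_A (n : ℕ) (k : Fin (m + 1)) : ∫ ω, M.A n ω k ∂μ = ∫ ω, M.X n ω k ∂μ := by
  have h := integral_congr_ae (M.hA_cond n {k})
  simpa only [integral_condExp (M.ℱ.le n), Finset.prod_singleton] using h

theorem integral_X_succ (n : ℕ) (k : Fin m) :
    ∫ ω, M.X (n + 1) ω k.succ ∂μ = (1 - M.α) * ∫ ω, M.X n ω k.succ ∂μ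
      + M.α * ∑ j : Fin m, M.T k.succ j.succ * ∫ ω, M.X n ω j.succ ∂μ := by
  have hA0 : ∫ ω, M.A n ω 0 ∂μ = 0 := integral_eq_zero_of_ae (M.hA_stub n)
  have hint : ∀ j, Integrable (fun ω => M.T k.succ j * M.A n ω j) μ :=
    fun j => (M.integrable_A n j).const_mul _
  simp_rw [M.h_update]
  rw [integral_add ((M.integrable_X n _).const_mul _)
      ((integrable_finsetSum _ fun j _ => hint j).const_mul _),
    integral_const_mul, integral_const_mul, integral_finsetSum _ fun j _ => hint j,
    Fin.sum_univ_succ]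
  simp_rw [integral_const_mul, hA0, M.integral_A]
  rw [mul_zero, zero_add]

theorem tendsto_integral_X_zero (k : Fin m) :
    Tendsto (fun n => ∫ ω, M.X n ω k.succ ∂μ) atTop (nhds 0) := by
  have hsum : ∀ i : Fin m, ∑ j : Fin m, M.T i.succ j.succ = 1 - M.T i.succ 0 := fun i => by
    rw [← M.hT_rowsum i.succ, Fin.sum_univ_succ, add_sub_cancel_left]
  refine tendsto_zero_of_lazy_substochastic (Q := Matrix.of fun a b : Fin m => M.T a.succ b.succ)
    (e := fun n i => ∫ ω, M.X n ω i.succ ∂μ)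
    (fun i j => M.hT_nonneg _ _)
    (fun i => (hsum i).trans_le (sub_le_self 1 (M.hT_nonneg _ _)))
    (fun i j => (M.hQ_irred i j).imp fun _ h => h.2)
    (M.hr_pos.imp fun i h => (hsum i).trans_lt (sub_lt_self 1 h))
    M.hα (fun n i => integral_nonneg fun ω => (M.hX_mem n ω _).1) (fun i => ?_)
    M.integral_X_succ k
  calc ∫ ω, M.X 0 ω i.succ ∂μ ≤ ∫ _, (1 : ℝ) ∂μ :=
        integral_mono (M.integrable_X 0 _) (integrable_const 1) fun ω => (M.hX_mem 0 ω _).2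
    _ = 1 := by simp

end RAStubbornModel

/-- **Ordinary agents' opinions become extremal with probability tending to one.**
In the RA model with a stubborn agent, for every `ε > 0` and every ordinary agent `k` (agent
`k+1`, i.e. coordinate `k` of `Y[n] = (X_2[n],…,X_K[n])`),
`P(Y_k[n] ≤ ε ∨ Y_k[n] ≥ 1 - ε) → 1` as `n → ∞`. -/
theorem RA_stubborn_extremal_concentration {m : ℕ} (hm : 1 ≤ m) {Ω : Type*} [MeasurableSpace Ω]
    {μ : Measure Ω} [IsProbabilityMeasure μ] (M : RAStubbornModel m Ω μ) :
    ∀ ε : ℝ, 0 < ε → ∀ k : Fin m,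
      Tendsto (fun n => μ {ω | M.X n ω k.succ ≤ ε ∨ 1 - ε ≤ M.X n ω k.succ})
        atTop (nhds 1) := by
  intro ε hε k
  have hbound : ∀ n, 1 - ENNReal.ofReal ((∫ ω, M.X n ω k.succ ∂μ) / ε) ≤
      μ {ω | M.X n ω k.succ ≤ ε ∨ 1 - ε ≤ M.X n ω k.succ} := by
    intro n
    have hmarkov : μ.real {ω | ε ≤ M.X n ω k.succ} ≤ (∫ ω, M.X n ω k.succ ∂μ) / ε := by
      rw [le_div_iff₀' hε]
      exact mul_meas_ge_le_integral_of_nonneg (ae_of_all _ fun ω => (M.hX_mem n ω k.succ).1)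
        (M.integrable_X n k.succ) ε
    rw [tsub_le_iff_right, ← measure_univ (μ := μ)]
    calc μ Set.univ ≤ μ ({ω | M.X n ω k.succ ≤ ε ∨ 1 - ε ≤ M.X n ω k.succ} ∪
          {ω | ε ≤ M.X n ω k.succ}) :=
          measure_mono fun ω _ => (le_total (M.X n ω k.succ) ε).imp Or.inl id
      _ ≤ _ := measure_union_le _ _
      _ ≤ _ := by
          gcongr
          rw [← ofReal_measureReal]
          exact ENNReal.ofReal_le_ofReal hmarkov
  refine tendsto_of_tendsto_of_tendsto_of_le_of_le ?_ tendsto_const_nhds hbound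
    fun n => prob_le_one
  have h := ENNReal.tendsto_ofReal ((M.tendsto_integral_X_zero k).div_const ε)
  rw [zero_div, ENNReal.ofReal_zero] at h
  simpa using ENNReal.Tendsto.sub tendsto_const_nhds h (Or.inl ENNReal.one_ne_top)
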